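/- arXiv:2003.03475 — 4 statements merged into one kernel-verified Lean document; each statement's English description precedes it below -/
import Mathlib

section
/- Let B be a real number with B > 1. Then there exists a unique z > 0 satisfying e^{−z} = 1 − z/B. -/
open Real

/-- By strict convexity, `e^{-z}` meets a line through `(0, 1)` at most once for `z > 0`. -/
theorem not_lt_of_exp_neg_eq_one_sub_div {B x y : ℝ} (hx : 0 < x)
    (hxB : Real.exp (-x) = 1 - x / B) (hyB : Real.exp (-y) = 1 - y / B) : ¬ x < y := by
  intro hxy
  have hy : 0 < y := hx.trans hxy
  have h := strictConvexOn_exp.2 (Set.mem_univ (-y)) (Set.mem_univ 0) (neg_ne_zero.2 hy.ne')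
    (div_pos hx hy) (sub_pos.2 ((div_lt_one hy).2 hxy)) (by ring)
  simp only [smul_eq_mul, mul_zero, add_zero, Real.exp_zero, mul_one] at h
  rw [show x / y * -y = -x by field_simp, hxB, hyB,
    show x / y * (1 - y / B) + (1 - x / y) = 1 - x / B by
      rw [mul_sub, div_mul_div_cancel₀ hy.ne']; ring] at h
  exact lt_irrefl _ h

/-- For `B > 1`, there exists a unique `z > 0` with `e^{-z} = 1 - z/B`. -/
theorem unique_solution_of_B_gt_one (B : ℝ) (hB : 1 < B) :
    ∃! z : ℝ, 0 < z ∧ Real.exp (-z) = 1 - z / B := by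
  have hB0 : 0 < B := zero_lt_one.trans hB
  have hlog : Real.log B < B - 1 := Real.log_lt_sub_one_of_pos hB0 hB.ne'
  have hcont : ContinuousOn (fun z : ℝ => Real.exp (-z) - (1 - z / B))
      (Set.Icc (Real.log B) B) := by fun_prop
  have hleft : Real.exp (-Real.log B) - (1 - Real.log B / B) ≤ 0 := by
    rw [Real.exp_neg, Real.exp_log hB0,
      show B⁻¹ - (1 - Real.log B / B) = (1 - B + Real.log B) / B by field_simp; ring]
    exact div_nonpos_of_nonpos_of_nonneg (by linarith) hB0.le
  have hright : 0 ≤ Real.exp (-B) - (1 - B / B) := by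
    rw [div_self hB0.ne', sub_self, sub_zero]
    positivity
  obtain ⟨z, hz, hzB⟩ := intermediate_value_Icc (by linarith) hcont ⟨hleft, hright⟩
  have hz0 : 0 < z := (Real.log_pos hB).trans_le hz.1
  have hzB' : Real.exp (-z) = 1 - z / B := sub_eq_zero.1 hzB
  refine ⟨z, ⟨hz0, hzB'⟩, fun w ⟨hw0, hwB⟩ => le_antisymm ?_ ?_⟩
  · exact not_lt.1 (not_lt_of_exp_neg_eq_one_sub_div hz0 hzB' hwB)
  · exact not_lt.1 (not_lt_of_exp_neg_eq_one_sub_div hw0 hwB hzB')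
end

section
/- Let a > 0 and β > 0. There exists k > 0 with k·(1 + coth(k·a)) = β if and only if β·a > 1; moreover, when β·a > 1 this k is unique. Consequently, the critical coupling constant for the one-dimensional Dirichlet problem with a delta potential at x = a equals β_cr = 1/a. -/
open Real

/-- Hyperbolic cotangent. -/
noncomputable def coth (x : ℝ) : ℝ := Real.cosh x / Real.sinh x

theorem mul_one_add_coth_eq_iff {a β k : ℝ} (ha : 0 < a) (hk : 0 < k) :
    k * (1 + coth (k * a)) = β ↔ β * a * (1 - exp (-(2 * k * a))) = 2 * k * a := by
  have hs : 0 < sinh (k * a) := sinh_pos_iff.2 (mul_pos hk ha)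
  have hcoth : 1 + coth (k * a) = exp (k * a) / sinh (k * a) := by
    rw [coth, ← cosh_add_sinh]
    field_simp
    ring
  have hsinh : 1 - exp (-(2 * k * a)) = 2 * sinh (k * a) / exp (k * a) := by
    rw [eq_div_iff (exp_ne_zero _), sinh_eq, sub_mul, ← exp_add]
    ring_nf
  have he : exp (k * a) ≠ 0 := exp_ne_zero _
  have hs' := hs.ne'
  rw [hcoth, hsinh, mul_div_assoc', mul_div_assoc', div_eq_iff hs', div_eq_iff he]
  constructor
  · intro h
    linear_combination (-2 * a) * h
  · intro h
    have h2a : 2 * a ≠ 0 := by positivity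
    apply mul_left_cancel₀ h2a
    linear_combination -h

theorem one_lt_of_mul_one_sub_exp_neg_eq {b t : ℝ} (ht : 0 < t)
    (h : b * (1 - exp (-t)) = t) : 1 < b := by
  have hlt : 1 - exp (-t) < t := by linarith [add_one_lt_exp (neg_ne_zero.2 ht.ne')]
  have hpos : 0 < 1 - exp (-t) := sub_pos.2 (exp_lt_one_iff.2 (neg_lt_zero.2 ht))
  by_contra! hb
  nlinarith

theorem exists_mul_one_sub_exp_neg_eq {b : ℝ} (hb : 1 < b) :
    ∃ t : ℝ, 0 < t ∧ b * (1 - exp (-t)) = t := by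
  have hb0 : 0 < b := one_pos.trans hb
  have hlog : log b < b - 1 := log_lt_sub_one_of_pos hb0 hb.ne'
  have hcont : ContinuousOn (fun t : ℝ => b * (1 - exp (-t)) - t) (Set.Icc (log b) b) := by
    fun_prop
  have hleft : 0 ≤ b * (1 - exp (-log b)) - log b := by
    rw [exp_neg, exp_log hb0, mul_sub, mul_inv_cancel₀ hb0.ne']
    linarith
  have hright : b * (1 - exp (-b)) - b ≤ 0 := by
    nlinarith [exp_pos (-b)]
  obtain ⟨t, ht, h⟩ := intermediate_value_Icc' (by linarith) hcont ⟨hright, hleft⟩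
  exact ⟨t, (log_pos hb).trans_le ht.1, sub_eq_zero.1 h⟩

theorem not_lt_of_mul_one_sub_exp_neg_eq {b s t : ℝ} (hs : 0 < s)
    (hbs : b * (1 - exp (-s)) = s) (hbt : b * (1 - exp (-t)) = t) : ¬ s < t := by
  intro hst
  have ht : 0 < t := hs.trans hst
  have hb : 0 < b := one_pos.trans (one_lt_of_mul_one_sub_exp_neg_eq hs hbs)
  have hconv := strictConvexOn_exp.2 (Set.mem_univ (-t)) (Set.mem_univ 0)
    (neg_ne_zero.2 ht.ne') (div_pos hs ht) (sub_pos.2 ((div_lt_one ht).2 hst))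
    (add_sub_cancel _ _)
  simp only [smul_eq_mul, mul_zero, add_zero, exp_zero, mul_one, mul_neg,
    div_mul_cancel₀ s ht.ne'] at hconv
  have hscale : s / t * (b * (1 - exp (-t))) = s := by rw [hbt, div_mul_cancel₀ s ht.ne']
  nlinarith [mul_lt_mul_of_pos_left hconv hb]

theorem mul_one_sub_exp_neg_eq_unique {b s t : ℝ} (hs : 0 < s) (ht : 0 < t)
    (hbs : b * (1 - exp (-s)) = s) (hbt : b * (1 - exp (-t)) = t) : s = t :=
  le_antisymm (not_lt.1 (not_lt_of_mul_one_sub_exp_neg_eq ht hbt hbs))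
    (not_lt.1 (not_lt_of_mul_one_sub_exp_neg_eq hs hbs hbt))

/-- For `a > 0` and `β > 0`, there exists `k > 0` with
`k·(1 + coth(k·a)) = β` iff `β·a > 1` (equivalently `β > 1/a`, so the critical
coupling constant is `β_cr = 1/a`); moreover when `β·a > 1` this `k` is unique. -/
theorem dirichlet_beta_cr_eq_inv_a (a β : ℝ) (ha : 0 < a) (hβ : 0 < β) :
    ((∃ k : ℝ, 0 < k ∧ k * (1 + coth (k * a)) = β) ↔ β * a > 1) ∧
    ((∃ k : ℝ, 0 < k ∧ k * (1 + coth (k * a)) = β) ↔ β > 1 / a) ∧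
    (β * a > 1 → ∃! k : ℝ, 0 < k ∧ k * (1 + coth (k * a)) = β) := by
  have hexu : β * a > 1 → ∃! k : ℝ, 0 < k ∧ k * (1 + coth (k * a)) = β := by
    intro hb
    obtain ⟨t, ht, h⟩ := exists_mul_one_sub_exp_neg_eq hb
    have hk : 0 < t / (2 * a) := by positivity
    have htk : 2 * (t / (2 * a)) * a = t := by field_simp
    refine ⟨t / (2 * a), ⟨hk, (mul_one_add_coth_eq_iff ha hk).2 (by rwa [htk])⟩, ?_⟩
    rintro k ⟨hk', h'⟩
    have := mul_one_sub_exp_neg_eq_unique (by positivity) ht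
      ((mul_one_add_coth_eq_iff ha hk').1 h') h
    rw [← this]
    field_simp
  have hiff : (∃ k : ℝ, 0 < k ∧ k * (1 + coth (k * a)) = β) ↔ β * a > 1 := by
    refine ⟨?_, fun hb => (hexu hb).exists⟩
    rintro ⟨k, hk, h⟩
    exact one_lt_of_mul_one_sub_exp_neg_eq (by positivity) ((mul_one_add_coth_eq_iff ha hk).1 h)
  exact ⟨hiff, hiff.trans (div_lt_iff₀ ha).symm, hexu⟩
end

section
/- For every a > 0 and every β > 0 there exists a unique k > 0 with k·(1 + tanh(k·a)) = β. Consequently, the one-dimensional Schrödinger operator with delta potential and Neumann boundary condition has a negative eigenvalue for every positive coupling constant, i.e. β_cr = 0. -/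
open Real

theorem strictMono_tanh : StrictMono Real.tanh := by
  intro x y hxy
  rw [Real.tanh_eq_sinh_div_cosh, Real.tanh_eq_sinh_div_cosh,
    div_lt_div_iff₀ (Real.cosh_pos x) (Real.cosh_pos y)]
  have h : 0 < Real.sinh (y - x) := Real.sinh_pos_iff.mpr (sub_pos.mpr hxy)
  rw [Real.sinh_sub] at h
  linarith

theorem strictMonoOn_mul_one_add_tanh {a : ℝ} (ha : 0 < a) :
    StrictMonoOn (fun k : ℝ => k * (1 + Real.tanh (k * a))) (Set.Ici 0) := by
  intro x hx y _ hxy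
  have hx : 0 ≤ x := hx
  have hmono : Real.tanh (x * a) < Real.tanh (y * a) :=
    strictMono_tanh (mul_lt_mul_of_pos_right hxy ha)
  have hnonneg : 0 ≤ Real.tanh (x * a) := by
    simpa using strictMono_tanh.monotone (mul_nonneg hx ha.le)
  have hpos : 0 ≤ 1 + Real.tanh (x * a) := by linarith
  exact mul_lt_mul'' hxy (by linarith) hx hpos

/-- For every `a > 0` and `β > 0` there is a unique `k > 0` with
`k·(1 + tanh(k·a)) = β`: the Neumann problem has a negative eigenvalue for every
positive coupling constant, i.e. `β_cr = 0`. -/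
theorem neumann_beta_cr_eq_zero (a β : ℝ) (ha : 0 < a) (hβ : 0 < β) :
    ∃! k : ℝ, 0 < k ∧ k * (1 + Real.tanh (k * a)) = β := by
  have hmono := strictMonoOn_mul_one_add_tanh ha
  have hcont : Continuous fun k : ℝ => k * (1 + Real.tanh (k * a)) := by
    simp only [Real.tanh_eq_sinh_div_cosh]
    fun_prop (disch := exact fun _ => (Real.cosh_pos _).ne')
  have hub : β ≤ β * (1 + Real.tanh (β * a)) := by
    have hnonneg : 0 ≤ Real.tanh (β * a) := by
      simpa using strictMono_tanh.monotone (mul_pos hβ ha).le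
    nlinarith
  obtain ⟨k, hk, hkβ⟩ := intermediate_value_Icc hβ.le hcont.continuousOn
    ⟨by simpa using hβ.le, hub⟩
  have hk0 : k ≠ 0 := by
    rintro rfl
    exact hβ.ne (by simpa using hkβ)
  refine ⟨k, ⟨hk.1.lt_of_ne' hk0, hkβ⟩, ?_⟩
  rintro y ⟨hy, hyβ⟩
  exact hmono.injOn hy.le hk.1 (hyβ.trans hkβ.symm)
end

section
/- Let a > 0, k > 0 and β ≥ 0 satisfy k·coth(k·a) > 1 and the Robin bound-state matching relation k + k·(k − coth(k·a))/(k·coth(k·a) − 1) = β. Then β < 2k; consequently the corresponding eigenvalue λ = −k² satisfies λ < −β²/4. -/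
open Real

lemma one_lt_coth {x : ℝ} (hx : 0 < x) : 1 < coth x := by
  rw [coth, one_lt_div (Real.sinh_pos_iff.2 hx)]
  exact Real.sinh_lt_cosh x

/-- If `a > 0`, `k > 0`, `β ≥ 0` satisfy `k·coth(k·a) > 1` and the Robin
bound-state matching relation `k + k·(k − coth(k·a))/(k·coth(k·a) − 1) = β`, then
`β < 2k`, hence the eigenvalue `λ = -k²` satisfies `λ < -β²/4`. -/
theorem robin_beta_lt_two_k (a k β : ℝ) (ha : 0 < a) (hk : 0 < k) (hβ : 0 ≤ β)
    (hgt : 1 < k * coth (k * a))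
    (hrel : k + k * ((k - coth (k * a)) / (k * coth (k * a) - 1)) = β) :
    β < 2 * k ∧ -(k ^ 2) < -(β ^ 2) / 4 := by
  have hlt : (k - coth (k * a)) / (k * coth (k * a) - 1) < 1 := by
    rw [div_lt_one (by linarith)]
    nlinarith [one_lt_coth (mul_pos hk ha)]
  have hβk : β < 2 * k := by
    rw [← hrel]
    linarith [mul_lt_mul_of_pos_left hlt hk]
  exact ⟨hβk, by nlinarith⟩
end
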